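/- arXiv:1909.01432 — 2 statements merged into one kernel-verified Lean document; each statement's English description precedes it below -/
import Mathlib

section
/- Let G be a finite simple graph on vertex set U with m edges, let V₁ and V₂ be two additional vertices, and for S ⊆ U let H_S be the simple graph on U ∪ {V₁, V₂} whose edges are exactly {(u, V₂) : u ∈ S} ∪ {(u, V₁) : u ∈ U \ S}. Then for every natural number k ≤ m: there exists S ⊆ U with cut_G(S) ≥ k if and only if there exists S ⊆ U with ∑ over edges (u_i,u_j) of G of the number of common neighbors of u_i and u_j in H_S at most m − k. -/
open Finset

/-- The graph on `U ⊕ {V₁, V₂}` (with `V₁ = Sum.inr false`, `V₂ = Sum.inr true`)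
whose edges are exactly `{(u, V₂) : u ∈ S} ∪ {(u, V₁) : u ∈ U \ S}`. -/
def doubleStarGraph {U : Type*} [DecidableEq U] (S : Finset U) : SimpleGraph (U ⊕ Bool) :=
  SimpleGraph.fromRel (fun x y =>
    (∃ u ∈ S, x = Sum.inl u ∧ y = Sum.inr true) ∨
    (∃ u, u ∉ S ∧ x = Sum.inl u ∧ y = Sum.inr false))

/-- The number of edges of `G` with exactly one endpoint in `S`. -/
def cutCount {U : Type*} [Fintype U] [DecidableEq U] (G : SimpleGraph U)
    [DecidableRel G.Adj] (S : Finset U) : ℕ :=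
  (G.edgeFinset.filter (fun e => ∃ a ∈ S, ∃ b, b ∉ S ∧ e = s(a, b))).card

/-- The number of common neighbors in `H_S` of the endpoints of an edge,
as a symmetric function on `Sym2`. -/
noncomputable def cnOfEdge {U : Type*} [Fintype U] [DecidableEq U] (S : Finset U) :
    Sym2 U → ℕ :=
  Sym2.lift ⟨fun a b =>
    ((doubleStarGraph S).commonNeighbors (Sum.inl a) (Sum.inl b)).ncard,
    fun _ _ => congrArg Set.ncard (SimpleGraph.commonNeighbors_symm _ _ _)⟩

theorem doubleStarGraph_neighborSet_inl {U : Type*} [DecidableEq U] (S : Finset U) (a : U) :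
    (doubleStarGraph S).neighborSet (Sum.inl a) = {Sum.inr (decide (a ∈ S))} := by
  ext (v | (_ | _)) <;> simp [doubleStarGraph]

theorem cnOfEdge_mk {U : Type*} [Fintype U] [DecidableEq U] (S : Finset U) (a b : U) :
    cnOfEdge S s(a, b) = if a ∈ S ↔ b ∈ S then 1 else 0 := by
  simp only [cnOfEdge, Sym2.lift_mk, SimpleGraph.commonNeighbors, doubleStarGraph_neighborSet_inl]
  split_ifs with h
  · simp [h]
  · rw [Set.singleton_inter_eq_empty.mpr (by simpa using h), Set.ncard_empty]

theorem cnOfEdge_eq_ite {U : Type*} [Fintype U] [DecidableEq U] (S : Finset U) (e : Sym2 U) :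
    cnOfEdge S e = if ∃ a ∈ S, ∃ b, b ∉ S ∧ e = s(a, b) then 0 else 1 := by
  induction e with
  | _ a b =>
    have h : (∃ x ∈ S, ∃ y, y ∉ S ∧ s(a, b) = s(x, y)) ↔ ¬(a ∈ S ↔ b ∈ S) := by
      constructor
      · rintro ⟨x, hx, y, hy, hxy⟩
        rcases Sym2.eq_iff.mp hxy with ⟨rfl, rfl⟩ | ⟨rfl, rfl⟩ <;> simp [hx, hy]
      · intro hab
        by_cases ha : a ∈ S
        · exact ⟨a, ha, b, fun hb => hab (by simp [ha, hb]), rfl⟩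
        · exact ⟨b, by_contra fun hb => hab (by simp [ha, hb]), a, ha, Sym2.eq_swap⟩
    simp only [cnOfEdge_mk, h, ite_not]

theorem cutCount_add_sum_cnOfEdge {U : Type*} [Fintype U] [DecidableEq U] (G : SimpleGraph U)
    [DecidableRel G.Adj] (S : Finset U) :
    cutCount G S + ∑ e ∈ G.edgeFinset, cnOfEdge S e = G.edgeFinset.card := by
  rw [cutCount, card_filter, ← sum_add_distrib, card_eq_sum_ones]
  refine sum_congr rfl fun e _ => ?_
  rw [cnOfEdge_eq_ite]
  split_ifs <;> rfl

/-- Correctness of the MaxCut reduction of Theorem 1: for `k ≤ m = |E(G)|`, there is a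
cut of size at least `k` iff there is `S` for which the total number of surviving
common neighbors over the edges of `G` is at most `m − k`. -/
theorem maxCut_reduction_correct {U : Type*} [Fintype U] [DecidableEq U]
    (G : SimpleGraph U) [DecidableRel G.Adj] (k : ℕ) (hk : k ≤ G.edgeFinset.card) :
    (∃ S : Finset U, k ≤ cutCount G S) ↔
    (∃ S : Finset U, ∑ e ∈ G.edgeFinset, cnOfEdge S e ≤ G.edgeFinset.card - k) := by
  refine exists_congr fun S => ?_
  have := cutCount_add_sum_cnOfEdge G S
  lia
end

section
/- Let G be a finite simple graph, v₁ ≠ v₂ two vertices, and w a common neighbor of v₁ and v₂. Let G₁ be G with edge (v₁,w) deleted and G₂ be G with edge (v₂,w) deleted. Then the Jaccard similarity of v₁ and v₂ is the same in G₁ and G₂: |N_{G₁}(v₁,v₂)| / (d_{G₁}(v₁) + d_{G₁}(v₂) − |N_{G₁}(v₁,v₂)|) = |N_{G₂}(v₁,v₂)| / (d_{G₂}(v₁) + d_{G₂}(v₂) − |N_{G₂}(v₁,v₂)|), both being equal to (|N_G(v₁,v₂)| − 1) / (d_G(v₁) + d_G(v₂) − |N_G(v₁,v₂)|). -/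
namespace SimpleGraph

variable {V : Type*} (G : SimpleGraph V) {u v w : V}

theorem neighborSet_deleteEdges_singleton (u w : V) :
    (G.deleteEdges {s(u, w)}).neighborSet u = G.neighborSet u \ {w} := by
  ext x
  simp only [mem_neighborSet, deleteEdges_adj, Set.mem_singleton_iff, Set.mem_sdiff, Sym2.eq_iff]
  grind

theorem neighborSet_deleteEdges_singleton_of_ne (huv : u ≠ v) (hwv : w ≠ v) :
    (G.deleteEdges {s(u, w)}).neighborSet v = G.neighborSet v := by
  ext x
  simp only [mem_neighborSet, deleteEdges_adj, Set.mem_singleton_iff, Sym2.eq_iff]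
  grind

theorem commonNeighbors_deleteEdges_singleton (huv : u ≠ v) (hwv : w ≠ v) :
    (G.deleteEdges {s(u, w)}).commonNeighbors u v = G.commonNeighbors u v \ {w} := by
  rw [commonNeighbors, commonNeighbors, neighborSet_deleteEdges_singleton,
    neighborSet_deleteEdges_singleton_of_ne G huv hwv]
  grind

/-- Deleting the edge from `u` to a common neighbor `w` of `u` and `v` lowers the number of common
neighbors by one and leaves the number of vertices adjacent to `u` or `v` unchanged. -/
theorem jaccard_deleteEdges_singleton [Finite V] (huv : u ≠ v)
    (hw : w ∈ G.commonNeighbors u v) :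
    (((G.deleteEdges {s(u, w)}).commonNeighbors u v).ncard : ℝ) /
        (((G.deleteEdges {s(u, w)}).neighborSet u).ncard +
          ((G.deleteEdges {s(u, w)}).neighborSet v).ncard -
          ((G.deleteEdges {s(u, w)}).commonNeighbors u v).ncard) =
      ((G.commonNeighbors u v).ncard - 1) /
        ((G.neighborSet u).ncard + (G.neighborSet v).ncard -
          (G.commonNeighbors u v).ncard) := by
  have hwv : w ≠ v := (G.ne_of_adj hw.2).symm
  rw [commonNeighbors_deleteEdges_singleton G huv hwv, neighborSet_deleteEdges_singleton,
    neighborSet_deleteEdges_singleton_of_ne G huv hwv,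
    ← Set.ncard_sdiff_singleton_add_one hw, ← Set.ncard_sdiff_singleton_add_one hw.1]
  push_cast
  congr 1 <;> ring

end SimpleGraph


/-- Jaccard is a symmetric local metric: deleting either edge of the tuple
`(v₁, w, v₂)` yields the same Jaccard similarity of `v₁` and `v₂`, namely
`(|N_G(v₁,v₂)| − 1) / (d_G(v₁) + d_G(v₂) − |N_G(v₁,v₂)|)`. -/
theorem jaccard_symmetric {V : Type*} [Fintype V]
    (G : SimpleGraph V) (v₁ v₂ : V) (h : v₁ ≠ v₂)
    (w : V) (hw : w ∈ G.commonNeighbors v₁ v₂) :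
    let N : SimpleGraph V → ℕ := fun H => (H.commonNeighbors v₁ v₂).ncard
    let d : SimpleGraph V → V → ℕ := fun H u => (H.neighborSet u).ncard
    let G₁ := G.deleteEdges {s(v₁, w)}
    let G₂ := G.deleteEdges {s(v₂, w)}
    (N G₁ : ℝ) / ((d G₁ v₁ : ℝ) + (d G₁ v₂ : ℝ) - (N G₁ : ℝ)) =
      (N G₂ : ℝ) / ((d G₂ v₁ : ℝ) + (d G₂ v₂ : ℝ) - (N G₂ : ℝ)) ∧
    (N G₁ : ℝ) / ((d G₁ v₁ : ℝ) + (d G₁ v₂ : ℝ) - (N G₁ : ℝ)) =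
      ((N G : ℝ) - 1) / ((d G v₁ : ℝ) + (d G v₂ : ℝ) - (N G : ℝ)) := by
  intro N d G₁ G₂
  have h₁ := G.jaccard_deleteEdges_singleton h hw
  have h₂ := G.jaccard_deleteEdges_singleton h.symm (G.commonNeighbors_symm v₁ v₂ ▸ hw)
  simp only [SimpleGraph.commonNeighbors_symm _ v₂ v₁,
    add_comm (((SimpleGraph.neighborSet _ v₂).ncard : ℝ))] at h₂
  exact ⟨h₁.trans h₂.symm, h₁⟩
end
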